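/- arXiv:2510.15390 — 2 statements merged into one kernel-verified Lean document; each statement's English description precedes it below -/
import Mathlib

section
/- Let (z, v, x) be jointly Gaussian with mean and covariance blocks as indicated, and let Λ be symmetric positive definite, z_j fixed. Then E[N(z_j | z, Λ) · v xᵀ] = N(z_j | m_z, Λ + S_{zz}) · (S_{vx|z_j} + m_{v|z_j} m_{x|z_j}ᵀ), where m_{a|z_j} = m_a + S_{az}(S_{zz}+Λ)⁻¹(z_j − m_z) and S_{ab|z_j} = S_{ab} − S_{az}(S_{zz}+Λ)⁻¹ S_{zb}. -/
open Matrix MeasureTheory Real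

/-- Multivariate Gaussian probability density on `ι → ℝ` with mean `m` and covariance `S`. -/
noncomputable def gpdf {ι : Type} [Fintype ι] [DecidableEq ι] (m : ι → ℝ) (S : Matrix ι ι ℝ) (x : ι → ℝ) : ℝ :=
  (2 * Real.pi) ^ (-(Fintype.card ι : ℝ) / 2) * S.det ^ (-(1 : ℝ) / 2) *
    Real.exp (-(1 / 2) * ((x - m) ⬝ᵥ (S⁻¹ *ᵥ (x - m))))


section Stmt7

variable {d n p : ℕ}

/-- z-z covariance block. -/
def Szz (S : Matrix (Fin d ⊕ (Fin n ⊕ Fin p)) (Fin d ⊕ (Fin n ⊕ Fin p)) ℝ) :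
    Matrix (Fin d) (Fin d) ℝ := Matrix.of fun a b => S (Sum.inl a) (Sum.inl b)

/-- v-z covariance block. -/
def Svz (S : Matrix (Fin d ⊕ (Fin n ⊕ Fin p)) (Fin d ⊕ (Fin n ⊕ Fin p)) ℝ) :
    Matrix (Fin n) (Fin d) ℝ := Matrix.of fun a b => S (Sum.inr (Sum.inl a)) (Sum.inl b)

/-- x-z covariance block. -/
def Sxz (S : Matrix (Fin d ⊕ (Fin n ⊕ Fin p)) (Fin d ⊕ (Fin n ⊕ Fin p)) ℝ) :
    Matrix (Fin p) (Fin d) ℝ := Matrix.of fun a b => S (Sum.inr (Sum.inr a)) (Sum.inl b)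

/-- v-x covariance block. -/
def Svx (S : Matrix (Fin d ⊕ (Fin n ⊕ Fin p)) (Fin d ⊕ (Fin n ⊕ Fin p)) ℝ) :
    Matrix (Fin n) (Fin p) ℝ := Matrix.of fun a b => S (Sum.inr (Sum.inl a)) (Sum.inr (Sum.inr b))

section Helpers
open ProbabilityTheory
open scoped MatrixOrder Matrix.Norms.L2Operator

lemma phi_moment_int (k : ℕ) :
    Integrable (fun x : ℝ => gaussianPDFReal 0 1 x * x ^ k) := by
  have h := (integrable_rpow_mul_exp_neg_mul_sq (b := 1/2) (by norm_num) (s := (k:ℝ))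
    (by have : (0:ℝ) ≤ k := Nat.cast_nonneg k
        linarith)).const_mul ((√(2 * π * ((1 : NNReal):ℝ)))⁻¹)
  refine h.congr (Filter.Eventually.of_forall fun x => ?_)
  simp only [gaussianPDFReal, Real.rpow_natCast]
  have : -(x - 0) ^ 2 / (2 * ((1:NNReal):ℝ)) = -(1/2) * x^2 := by push_cast; ring
  rw [this]; ring

lemma phi_moment (k : ℕ) (hk : k ≤ 2) :
    ∫ x : ℝ, gaussianPDFReal 0 1 x * x ^ k = if k = 1 then 0 else 1 := by
  have h := integral_gaussianReal_eq_integral_smul (μ := 0) (v := 1) (f := fun x : ℝ => x ^ k) one_ne_zero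
  simp only [smul_eq_mul] at h
  rw [← h]
  interval_cases k
  · simp
  · simp
  · have h2 := variance_fun_id_gaussianReal (μ := 0) (v := 1)
    rw [variance_eq_integral (by fun_prop)] at h2
    simpa using h2

variable {ι : Type} [Fintype ι] [DecidableEq ι]

/-- Standard Gaussian density. -/
noncomputable def Phi (u : ι → ℝ) : ℝ := ∏ i, gaussianPDFReal 0 1 (u i)

lemma Phi_pow_int (e : ι → ℕ) :
    Integrable (fun u : ι → ℝ => Phi u * ∏ i, u i ^ e i) := by
  simp only [Phi, ← Finset.prod_mul_distrib]
  exact Integrable.fintype_prod (f := fun i x => gaussianPDFReal 0 1 x * x ^ e i)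
    (fun i => phi_moment_int _)

lemma Phi_pow (e : ι → ℕ) (he : ∀ i, e i ≤ 2) :
    ∫ u : ι → ℝ, Phi u * ∏ i, u i ^ e i = ∏ i, if e i = 1 then 0 else 1 := by
  simp only [Phi, ← Finset.prod_mul_distrib]
  rw [integral_fintype_prod_volume_eq_prod (fun i x => gaussianPDFReal 0 1 x * x ^ e i)]
  exact Finset.prod_congr rfl fun i _ => phi_moment _ (he i)

lemma Phi0 : Integrable (fun u : ι → ℝ => Phi u) ∧ ∫ u : ι → ℝ, Phi u = 1 := by
  have h1 := Phi_pow_int (ι := ι) (fun _ => 0)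
  have h2 := Phi_pow (ι := ι) (fun _ => 0) (by simp)
  simp at h1 h2
  exact ⟨h1, h2⟩

lemma prod1 (u : ι → ℝ) (c : ι) : ∏ i, u i ^ (if i = c then 1 else 0) = u c := by
  simp [pow_ite]

lemma Phi1 (c : ι) : Integrable (fun u : ι → ℝ => Phi u * u c) ∧ ∫ u : ι → ℝ, Phi u * u c = 0 := by
  have he : ∀ i, (if i = c then 1 else 0) ≤ 2 := fun i => by split_ifs <;> norm_num
  have h1 := Phi_pow_int (ι := ι) (fun i => if i = c then 1 else 0)
  have h2 := Phi_pow (ι := ι) (fun i => if i = c then 1 else 0) he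
  simp only [prod1] at h1 h2
  refine ⟨h1, h2.trans ?_⟩
  exact Finset.prod_eq_zero (Finset.mem_univ c) (by simp)

lemma Phi2 (c d : ι) : Integrable (fun u : ι → ℝ => Phi u * (u c * u d)) ∧
    ∫ u : ι → ℝ, Phi u * (u c * u d) = if c = d then 1 else 0 := by
  have he : ∀ i, (if i = c then 1 else 0) + (if i = d then 1 else 0) ≤ 2 :=
    fun i => by split_ifs <;> norm_num
  have h1 := Phi_pow_int (ι := ι) (fun i => (if i = c then 1 else 0) + (if i = d then 1 else 0))
  have h2 := Phi_pow (ι := ι) (fun i => (if i = c then 1 else 0) + (if i = d then 1 else 0)) he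
  simp only [pow_add, Finset.prod_mul_distrib, prod1] at h1 h2
  refine ⟨h1, h2.trans ?_⟩
  split_ifs with h
  · subst h
    exact Finset.prod_eq_one fun i _ => by split_ifs <;> simp_all
  · exact Finset.prod_eq_zero (Finset.mem_univ c) (by simp [h])

/-- second moments of affine images -/
lemma Phi_affine (m : ι → ℝ) (B : Matrix ι ι ℝ) (a b : ι) :
    ∫ u : ι → ℝ, Phi u * ((m + B *ᵥ u) a * (m + B *ᵥ u) b) = (B * Bᵀ) a b + m a * m b := by
  have key : ∀ u : ι → ℝ, Phi u * ((m + B *ᵥ u) a * (m + B *ᵥ u) b) =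
      (∑ c, ∑ d, B a c * B b d * (Phi u * (u c * u d))) +
      ((∑ c, m b * B a c * (Phi u * u c)) + (∑ c, m a * B b c * (Phi u * u c))) +
      m a * m b * Phi u := by
    intro u
    have e1 : (∑ c, ∑ d, B a c * B b d * (Phi u * (u c * u d))) =
        Phi u * ((∑ c, B a c * u c) * (∑ d, B b d * u d)) := by
      rw [Finset.sum_mul_sum, Finset.mul_sum]
      refine Finset.sum_congr rfl fun c _ => ?_
      rw [Finset.mul_sum]
      exact Finset.sum_congr rfl fun d _ => by ring
    have e2 : ∀ (s : ℝ) (a : ι), (∑ c, s * B a c * (Phi u * u c)) =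
        s * Phi u * (∑ c, B a c * u c) := by
      intro s a
      rw [Finset.mul_sum]
      exact Finset.sum_congr rfl fun d _ => by ring
    rw [e1, e2, e2]
    simp only [Pi.add_apply, mulVec, dotProduct]
    ring
  simp only [key]
  have i0 := (Phi0 (ι := ι)).1.const_mul (m a * m b)
  have i1 : ∀ (s : ℝ) (a : ι), Integrable (fun u : ι → ℝ => ∑ c, s * B a c * (Phi u * u c)) :=
    fun s a => integrable_finsetSum _ fun c _ => (Phi1 c).1.const_mul _
  have i2pre : ∀ c, Integrable (fun u : ι → ℝ => ∑ d, B a c * B b d * (Phi u * (u c * u d))) :=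
    fun c => integrable_finsetSum _ fun d _ => (Phi2 c d).1.const_mul _
  have i2 : Integrable (fun u : ι → ℝ => ∑ c, ∑ d, B a c * B b d * (Phi u * (u c * u d))) :=
    integrable_finsetSum _ fun c _ => i2pre c
  have v1 : ∀ (s : ℝ) (a : ι), ∫ u : ι → ℝ, ∑ c, s * B a c * (Phi u * u c) = 0 := by
    intro s a
    rw [integral_finsetSum _ fun c _ => (Phi1 c).1.const_mul _]
    exact Finset.sum_eq_zero fun c _ => by rw [integral_const_mul, (Phi1 c).2, mul_zero]
  have v2 : ∫ u : ι → ℝ, ∑ c, ∑ d, B a c * B b d * (Phi u * (u c * u d)) = (B * Bᵀ) a b := by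
    rw [integral_finsetSum _ fun c _ => i2pre c, Matrix.mul_apply]
    refine Finset.sum_congr rfl fun c _ => ?_
    rw [integral_finsetSum _ fun d _ => (Phi2 c d).1.const_mul _]
    simp [integral_const_mul, (Phi2 c _).2]
  have i3 : Integrable (fun u : ι → ℝ => (∑ c, m b * B a c * (Phi u * u c)) +
      (∑ c, m a * B b c * (Phi u * u c))) := (i1 _ _).add (i1 _ _)
  have i4 : Integrable (fun u : ι → ℝ => (∑ c, ∑ d, B a c * B b d * (Phi u * (u c * u d))) +
      ((∑ c, m b * B a c * (Phi u * u c)) + (∑ c, m a * B b c * (Phi u * u c)))) := i2.add i3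
  rw [integral_add i4 i0, integral_add i2 i3, integral_add (i1 _ _) (i1 _ _), v1, v1, v2, integral_const_mul, (Phi0 (ι := ι)).2]
  ring

lemma gpdf_affine (m : ι → ℝ) (B : Matrix ι ι ℝ) (hB : B.det ≠ 0) (u : ι → ℝ) :
    |B.det| * gpdf m (B * Bᵀ) (m + B *ᵥ u) = Phi u := by
  have hu : IsUnit B.det := isUnit_iff_ne_zero.mpr hB
  have hq : (B *ᵥ u) ⬝ᵥ ((B * Bᵀ)⁻¹ *ᵥ (B *ᵥ u)) = u ⬝ᵥ u := by
    rw [Matrix.mul_inv_rev, mulVec_mulVec, Matrix.mul_assoc, Matrix.nonsing_inv_mul _ hu,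
      Matrix.mul_one, ← Matrix.transpose_nonsing_inv, Matrix.mulVec_transpose,
      dotProduct_comm, ← Matrix.dotProduct_mulVec, mulVec_mulVec, Matrix.nonsing_inv_mul _ hu,
      one_mulVec]
  have hd : (B * Bᵀ).det = |B.det| ^ (2:ℝ) := by
    rw [Matrix.det_mul, Matrix.det_transpose, Real.rpow_two, sq_abs, sq]
  have hp : 0 < |B.det| := abs_pos.mpr hB
  have h2 : (|B.det| ^ (2:ℝ)) ^ (-(1:ℝ)/2) = |B.det|⁻¹ := by
    rw [← Real.rpow_mul hp.le, ← Real.rpow_neg_one]; norm_num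
  have hpi : (2 * π) ^ (-(Fintype.card ι : ℝ) / 2) = ∏ i : ι, (√(2 * π))⁻¹ := by
    rw [Finset.prod_const, Finset.card_univ, Real.sqrt_eq_rpow, ← Real.rpow_neg (by positivity),
      ← Real.rpow_natCast, ← Real.rpow_mul (by positivity)]
    congr 1; ring
  unfold gpdf
  rw [add_sub_cancel_left, hq, hd, h2, hpi]
  simp only [Phi, gaussianPDFReal, Finset.prod_mul_distrib]
  rw [← Real.exp_sum]
  have : ∑ i, -(u i - 0) ^ 2 / (2 * ((1:NNReal):ℝ)) = -(1/2) * (u ⬝ᵥ u) := by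
    simp only [dotProduct, Finset.mul_sum]
    exact Finset.sum_congr rfl fun i _ => by push_cast; ring
  rw [this]
  simp only [NNReal.coe_one, mul_one]
  field_simp

lemma gpdf_second (m : ι → ℝ) (T : Matrix ι ι ℝ) (hT : T.PosDef) (a b : ι) :
    ∫ w : ι → ℝ, gpdf m T w * (w a * w b) = T a b + m a * m b := by
  obtain ⟨B, hB⟩ : ∃ B : Matrix ι ι ℝ, T = B * Bᵀ := by
    obtain ⟨C, hC⟩ := CStarAlgebra.nonneg_iff_eq_star_mul_self.mp hT.posSemidef.nonneg
    exact ⟨Cᵀ, by simpa [star_eq_conjTranspose] using hC⟩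
  have hd : B.det ≠ 0 := by
    intro h
    have := hT.det_pos
    rw [hB, det_mul, h, zero_mul] at this
    exact lt_irrefl _ this
  have hu : IsUnit B.det := isUnit_iff_ne_zero.mpr hd
  have hF : ∀ u : ι → ℝ, HasFDerivAt (fun u : ι → ℝ => m + B *ᵥ u)
      (LinearMap.toContinuousLinearMap (Matrix.toLin' B)) u := fun u =>
    (LinearMap.toContinuousLinearMap (Matrix.toLin' B)).hasFDerivAt.const_add m
  have hinj : Set.InjOn (fun u : ι → ℝ => m + B *ᵥ u) Set.univ := by
    intro x _ y _ h
    have h := congrArg (fun v => B⁻¹ *ᵥ v) (add_left_cancel h)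
    simpa [mulVec_mulVec, Matrix.nonsing_inv_mul _ hu] using h
  have himg : (fun u : ι → ℝ => m + B *ᵥ u) '' Set.univ = Set.univ := by
    rw [Set.image_univ, Set.range_eq_univ]
    intro y
    exact ⟨B⁻¹ *ᵥ (y - m), by simp [mulVec_mulVec, Matrix.mul_nonsing_inv _ hu]⟩
  have h := integral_image_eq_integral_abs_det_fderiv_smul volume MeasurableSet.univ
    (fun u _ => (hF u).hasFDerivWithinAt) hinj (fun w => gpdf m T w * (w a * w b))
  rw [himg] at h
  simp only [Measure.restrict_univ] at h
  rw [h, hB, ← Phi_affine]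
  refine integral_congr_ae (Filter.Eventually.of_forall fun u => ?_)
  simp only [smul_eq_mul]
  rw [← gpdf_affine m B hd u]
  have : (LinearMap.toContinuousLinearMap (Matrix.toLin' B)).det = B.det := by
    simp [ContinuousLinearMap.det]
  rw [this]; ring

variable {κ : Type} [Fintype κ] [DecidableEq κ]

lemma post_alg (S : Matrix ι ι ℝ) (hS : S.PosDef) (L : Matrix κ κ ℝ) (hL : L.PosDef)
    (E : Matrix κ ι ℝ) :
    (S⁻¹ + Eᵀ * L⁻¹ * E).PosDef ∧ (L + E * S * Eᵀ).PosDef ∧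
    (S⁻¹ + Eᵀ * L⁻¹ * E)⁻¹ = S - S * Eᵀ * (L + E * S * Eᵀ)⁻¹ * E * S ∧
    (S⁻¹ + Eᵀ * L⁻¹ * E)⁻¹.det * (L + E * S * Eᵀ).det = S.det * L.det := by
  have hP : (S⁻¹ + Eᵀ * L⁻¹ * E).PosDef := hS.inv.add_posSemidef (by
    simpa using hL.inv.posSemidef.conjTranspose_mul_mul_same E)
  have hG : (L + E * S * Eᵀ).PosDef := hL.add_posSemidef (by
    simpa using hS.posSemidef.mul_mul_conjTranspose_same E)
  have uS : IsUnit S.det := hS.det_pos.ne'.isUnit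
  have uL : IsUnit L.det := hL.det_pos.ne'.isUnit
  have uG : IsUnit (L + E * S * Eᵀ).det := hG.det_pos.ne'.isUnit
  have hPS : (S⁻¹ + Eᵀ * L⁻¹ * E) * S = 1 + Eᵀ * L⁻¹ * E * S := by
    rw [Matrix.add_mul, Matrix.nonsing_inv_mul _ uS]
  have hPSE : (S⁻¹ + Eᵀ * L⁻¹ * E) * S * Eᵀ = Eᵀ * L⁻¹ * (L + E * S * Eᵀ) := by
    rw [hPS, Matrix.add_mul, Matrix.mul_add, Matrix.one_mul, Matrix.mul_assoc Eᵀ L⁻¹ L,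
      Matrix.nonsing_inv_mul _ uL, Matrix.mul_one]
    simp only [Matrix.mul_assoc]
  refine ⟨hP, hG, ?_, ?_⟩
  · apply Matrix.inv_eq_right_inv
    rw [Matrix.mul_sub]
    have : (S⁻¹ + Eᵀ * L⁻¹ * E) * (S * Eᵀ * (L + E * S * Eᵀ)⁻¹ * E * S) =
        Eᵀ * L⁻¹ * E * S := by
      calc _ = ((S⁻¹ + Eᵀ * L⁻¹ * E) * S * Eᵀ) * (L + E * S * Eᵀ)⁻¹ * E * S := by
            simp only [Matrix.mul_assoc]
        _ = _ := by
            rw [hPSE, Matrix.mul_assoc (Eᵀ * L⁻¹), Matrix.mul_nonsing_inv _ uG, Matrix.mul_one]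
    rw [this, hPS, add_sub_cancel_right]
  · have h1 : (S⁻¹ + Eᵀ * L⁻¹ * E).det * S.det = (1 + L⁻¹ * E * S * Eᵀ).det := by
      rw [← det_mul, hPS]
      have := Matrix.det_one_add_mul_comm Eᵀ (L⁻¹ * E * S)
      simpa only [Matrix.mul_assoc] using this
    have h2 : (L + E * S * Eᵀ).det = L.det * (1 + L⁻¹ * E * S * Eᵀ).det := by
      rw [← det_mul, Matrix.mul_add, Matrix.mul_one]
      congr 2
      simp only [← Matrix.mul_assoc]
      rw [Matrix.mul_nonsing_inv _ uL, Matrix.one_mul]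
    rw [h2, ← h1, Matrix.det_nonsing_inv, Ring.inverse_eq_inv']
    have := hP.det_pos.ne'
    field_simp

lemma complete_square (S : Matrix ι ι ℝ) (hS : S.PosDef) (L : Matrix κ κ ℝ) (hL : L.PosDef)
    (E : Matrix κ ι ℝ) (y : ι → ℝ) (r : κ → ℝ) :
    y ⬝ᵥ (S⁻¹ *ᵥ y) + (r - E *ᵥ y) ⬝ᵥ (L⁻¹ *ᵥ (r - E *ᵥ y)) =
    (y - (S * Eᵀ * (L + E * S * Eᵀ)⁻¹) *ᵥ r) ⬝ᵥ ((S⁻¹ + Eᵀ * L⁻¹ * E) *ᵥ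
      (y - (S * Eᵀ * (L + E * S * Eᵀ)⁻¹) *ᵥ r)) + r ⬝ᵥ ((L + E * S * Eᵀ)⁻¹ *ᵥ r) := by
  obtain ⟨hP, hG, -, -⟩ := post_alg S hS L hL E
  have uS : IsUnit S.det := hS.det_pos.ne'.isUnit
  have uL : IsUnit L.det := hL.det_pos.ne'.isUnit
  have uG : IsUnit (L + E * S * Eᵀ).det := hG.det_pos.ne'.isUnit
  have tP : (S⁻¹ + Eᵀ * L⁻¹ * E)ᵀ = S⁻¹ + Eᵀ * L⁻¹ * E := by simpa using hP.isHermitian.eq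
  have tL : (L⁻¹)ᵀ = L⁻¹ := by simpa using hL.inv.isHermitian.eq
  have hPSE : (S⁻¹ + Eᵀ * L⁻¹ * E) * S * Eᵀ = Eᵀ * L⁻¹ * (L + E * S * Eᵀ) := by
    rw [Matrix.add_mul, Matrix.nonsing_inv_mul _ uS, Matrix.add_mul, Matrix.mul_add,
      Matrix.one_mul, Matrix.mul_assoc Eᵀ L⁻¹ L, Matrix.nonsing_inv_mul _ uL, Matrix.mul_one]
    simp only [Matrix.mul_assoc]
  have hPy : ∀ y : ι → ℝ, y ⬝ᵥ ((S⁻¹ + Eᵀ * L⁻¹ * E) *ᵥ y) =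
      y ⬝ᵥ (S⁻¹ *ᵥ y) + (E *ᵥ y) ⬝ᵥ (L⁻¹ *ᵥ (E *ᵥ y)) := by
    intro y
    rw [add_mulVec, dotProduct_add, ← mulVec_mulVec, ← mulVec_mulVec, dotProduct_mulVec y Eᵀ,
      vecMul_transpose]
  set k := (S * Eᵀ * (L + E * S * Eᵀ)⁻¹) *ᵥ r with hk
  have hPk : (S⁻¹ + Eᵀ * L⁻¹ * E) *ᵥ k = Eᵀ *ᵥ (L⁻¹ *ᵥ r) := by
    rw [hk, mulVec_mulVec, ← Matrix.mul_assoc, ← Matrix.mul_assoc, hPSE, Matrix.mul_assoc,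
      Matrix.mul_nonsing_inv _ uG, Matrix.mul_one, mulVec_mulVec]
  have hEk : E *ᵥ k = r - L *ᵥ ((L + E * S * Eᵀ)⁻¹ *ᵥ r) := by
    have h : r = (L + E * S * Eᵀ) *ᵥ ((L + E * S * Eᵀ)⁻¹ *ᵥ r) := by
      rw [mulVec_mulVec, Matrix.mul_nonsing_inv _ uG, one_mulVec]
    rw [eq_sub_iff_add_eq]
    conv_rhs => rw [h, add_mulVec]
    rw [hk, mulVec_mulVec, mulVec_mulVec _ (E * S * Eᵀ), add_comm]
    simp only [Matrix.mul_assoc]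
  have symL : ∀ a b : κ → ℝ, a ⬝ᵥ (L⁻¹ *ᵥ b) = b ⬝ᵥ (L⁻¹ *ᵥ a) := by
    intro a b
    rw [dotProduct_mulVec, ← mulVec_transpose, tL, dotProduct_comm]
  have hyk : ∀ x : ι → ℝ, x ⬝ᵥ ((S⁻¹ + Eᵀ * L⁻¹ * E) *ᵥ k) = (E *ᵥ x) ⬝ᵥ (L⁻¹ *ᵥ r) := by
    intro x
    rw [hPk, dotProduct_mulVec, vecMul_transpose]
  have hky : k ⬝ᵥ ((S⁻¹ + Eᵀ * L⁻¹ * E) *ᵥ y) = (E *ᵥ y) ⬝ᵥ (L⁻¹ *ᵥ r) := by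
    rw [dotProduct_mulVec, ← mulVec_transpose, tP, dotProduct_comm, hyk]
  have hkk : (E *ᵥ k) ⬝ᵥ (L⁻¹ *ᵥ r) = r ⬝ᵥ (L⁻¹ *ᵥ r) - r ⬝ᵥ ((L + E * S * Eᵀ)⁻¹ *ᵥ r) := by
    rw [hEk, sub_dotProduct, symL (L *ᵥ _), mulVec_mulVec, Matrix.nonsing_inv_mul _ uL, one_mulVec]
  simp only [mulVec_sub, dotProduct_sub, sub_dotProduct]
  rw [hyk, hyk, hky, hkk, hPy, symL r (E *ᵥ y)]
  ring

lemma gpdf_mul (M : ι → ℝ) (S : Matrix ι ι ℝ) (hS : S.PosDef) (L : Matrix κ κ ℝ) (hL : L.PosDef)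
    (E : Matrix κ ι ℝ) (z : κ → ℝ) (w : ι → ℝ) :
    gpdf M S w * gpdf (E *ᵥ w) L z = gpdf (E *ᵥ M) (L + E * S * Eᵀ) z *
      gpdf (M + (S * Eᵀ * (L + E * S * Eᵀ)⁻¹) *ᵥ (z - E *ᵥ M)) (S⁻¹ + Eᵀ * L⁻¹ * E)⁻¹ w := by
  obtain ⟨hP, hG, -, hdet⟩ := post_alg S hS L hL E
  have hsq := complete_square S hS L hL E (w - M) (z - E *ᵥ M)
  have e1 : z - E *ᵥ M - E *ᵥ (w - M) = z - E *ᵥ w := by rw [mulVec_sub]; abel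
  rw [e1, sub_sub] at hsq
  unfold gpdf
  rw [Matrix.nonsing_inv_nonsing_inv _ hP.det_pos.ne'.isUnit]
  have hd : S.det ^ (-(1:ℝ)/2) * L.det ^ (-(1:ℝ)/2) =
      (S⁻¹ + Eᵀ * L⁻¹ * E)⁻¹.det ^ (-(1:ℝ)/2) * (L + E * S * Eᵀ).det ^ (-(1:ℝ)/2) := by
    rw [← Real.mul_rpow hS.det_pos.le hL.det_pos.le,
      ← Real.mul_rpow hP.inv.det_pos.le hG.det_pos.le, hdet]
  have he := congrArg (fun t => Real.exp (-(1/2) * t)) hsq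
  simp only [mul_add, Real.exp_add] at he
  linear_combination (2 * π) ^ (-(Fintype.card ι : ℝ) / 2) * (2 * π) ^ (-(Fintype.card κ : ℝ) / 2) *
    (S.det ^ (-(1:ℝ)/2) * L.det ^ (-(1:ℝ)/2)) * he +
    (2 * π) ^ (-(Fintype.card ι : ℝ) / 2) * (2 * π) ^ (-(Fintype.card κ : ℝ) / 2) *
    (rexp (-(1/2) * ((w - (M + (S * Eᵀ * (L + E * S * Eᵀ)⁻¹) *ᵥ (z - E *ᵥ M))) ⬝ᵥ
      ((S⁻¹ + Eᵀ * L⁻¹ * E) *ᵥ (w - (M + (S * Eᵀ * (L + E * S * Eᵀ)⁻¹) *ᵥ (z - E *ᵥ M)))))) *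
     rexp (-(1/2) * ((z - E *ᵥ M) ⬝ᵥ ((L + E * S * Eᵀ)⁻¹ *ᵥ (z - E *ᵥ M))))) * hd

lemma general (M : ι → ℝ) (S : Matrix ι ι ℝ) (hS : S.PosDef) (L : Matrix κ κ ℝ) (hL : L.PosDef)
    (E : Matrix κ ι ℝ) (z : κ → ℝ) (a b : ι) :
    ∫ w : ι → ℝ, gpdf M S w * gpdf (E *ᵥ w) L z * (w a * w b) =
      gpdf (E *ᵥ M) (L + E * S * Eᵀ) z *
      ((S - S * Eᵀ * (L + E * S * Eᵀ)⁻¹ * E * S) a b +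
       (M a + ((S * Eᵀ * (L + E * S * Eᵀ)⁻¹) *ᵥ (z - E *ᵥ M)) a) *
       (M b + ((S * Eᵀ * (L + E * S * Eᵀ)⁻¹) *ᵥ (z - E *ᵥ M)) b)) := by
  obtain ⟨hP, hG, hW, -⟩ := post_alg S hS L hL E
  simp only [gpdf_mul M S hS L hL E z, mul_assoc]
  rw [integral_const_mul, gpdf_second _ _ hP.inv, hW]
  simp only [Pi.add_apply, Matrix.mul_assoc]

end Helpers

/-- For jointly Gaussian `(z, v, x)` and fixed `z_j`,
`E[N(z_j|z,Λ) · v xᵀ] = N(z_j|m_z, Λ+S_zz) · (S_{vx|z_j} + m_{v|z_j} m_{x|z_j}ᵀ)` where the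
conditional moments are given by the Kalman-filter-type update. -/
theorem stmt7
    (M : (Fin d ⊕ (Fin n ⊕ Fin p)) → ℝ)
    (S : Matrix (Fin d ⊕ (Fin n ⊕ Fin p)) (Fin d ⊕ (Fin n ⊕ Fin p)) ℝ)
    (hS : S.PosDef)
    (Lam : Matrix (Fin d) (Fin d) ℝ) (hLam : Lam.PosDef)
    (zj : Fin d → ℝ) (i : Fin n) (j : Fin p) :
    (∫ w : (Fin d ⊕ (Fin n ⊕ Fin p)) → ℝ,
        gpdf M S w * gpdf (fun a => w (Sum.inl a)) Lam zj *
          (w (Sum.inr (Sum.inl i)) * w (Sum.inr (Sum.inr j))))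
      = gpdf (fun a => M (Sum.inl a)) (Lam + Szz S) zj *
          ((Svx S - Svz S * (Szz S + Lam)⁻¹ * (Sxz S)ᵀ) i j +
            (M (Sum.inr (Sum.inl i)) +
              ((Svz S * (Szz S + Lam)⁻¹) *ᵥ (zj - fun a => M (Sum.inl a))) i) *
            (M (Sum.inr (Sum.inr j)) +
              ((Sxz S * (Szz S + Lam)⁻¹) *ᵥ (zj - fun a => M (Sum.inl a))) j)) := by
  classical
  let E : Matrix (Fin d) (Fin d ⊕ (Fin n ⊕ Fin p)) ℝ :=
    Matrix.of fun a b => if b = Sum.inl a then 1 else 0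
  have hE : ∀ w : (Fin d ⊕ (Fin n ⊕ Fin p)) → ℝ, E *ᵥ w = fun a => w (Sum.inl a) := by
    intro w; funext a
    simp only [E, mulVec, dotProduct, Matrix.of_apply, ite_mul, one_mul, zero_mul,
      Finset.sum_ite_eq', Finset.mem_univ, if_true]
  have hSE : ∀ a b, (S * Eᵀ) a b = S a (Sum.inl b) := by
    intro a b
    simp only [E, Matrix.mul_apply, Matrix.transpose_apply, Matrix.of_apply, mul_ite, mul_one,
      mul_zero, Finset.sum_ite_eq', Finset.mem_univ, if_true]
  have hES : ∀ a b, (E * S) a b = S (Sum.inl a) b := by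
    intro a b
    simp only [E, Matrix.mul_apply, Matrix.of_apply, ite_mul, one_mul,
      zero_mul, Finset.sum_ite_eq', Finset.mem_univ, if_true]
  have hsym : ∀ a b, S a b = S b a := fun a b => by
    simpa using (hS.isHermitian.apply a b).symm
  have hG : E * S * Eᵀ = Szz S := by
    ext a b
    rw [Matrix.mul_assoc]
    simp only [Szz, Matrix.of_apply]
    rw [← hSE]
    have := congrFun (hE (fun c => (S * Eᵀ) c b)) a
    simpa [mulVec, dotProduct, Matrix.mul_apply] using this
  have h := general M S hS Lam hLam E zj (Sum.inr (Sum.inl i)) (Sum.inr (Sum.inr j))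
  simp only [hE, hG] at h
  rw [h, add_comm (Szz S) Lam]
  have r1 : ∀ (K : Matrix (Fin d) (Fin d) ℝ) (c : Fin d),
      (S * Eᵀ * K) (Sum.inr (Sum.inl i)) c = (Svz S * K) i c := by
    intro K c
    rw [Matrix.mul_apply, Matrix.mul_apply]
    simp only [hSE, Svz, Matrix.of_apply]
  have r2 : ∀ (K : Matrix (Fin d) (Fin d) ℝ) (c : Fin d),
      (S * Eᵀ * K) (Sum.inr (Sum.inr j)) c = (Sxz S * K) j c := by
    intro K c
    rw [Matrix.mul_apply, Matrix.mul_apply]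
    simp only [hSE, Sxz, Matrix.of_apply]
  have r3 : (S - S * Eᵀ * (Lam + Szz S)⁻¹ * E * S) (Sum.inr (Sum.inl i)) (Sum.inr (Sum.inr j)) =
      (Svx S - Svz S * (Lam + Szz S)⁻¹ * (Sxz S)ᵀ) i j := by
    rw [Matrix.sub_apply, Matrix.sub_apply, Matrix.mul_assoc _ E S, Matrix.mul_apply,
      Matrix.mul_apply (M := Svz S * (Lam + Szz S)⁻¹)]
    simp only [r1, hES, Svx, Matrix.of_apply, Matrix.transpose_apply, Sxz,
      hsym (Sum.inr (Sum.inr j))]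
  have r4 : ∀ y : Fin d → ℝ, ((S * Eᵀ * (Lam + Szz S)⁻¹) *ᵥ y) (Sum.inr (Sum.inl i)) =
      ((Svz S * (Lam + Szz S)⁻¹) *ᵥ y) i := by
    intro y
    simp only [mulVec, dotProduct, r1]
  have r5 : ∀ y : Fin d → ℝ, ((S * Eᵀ * (Lam + Szz S)⁻¹) *ᵥ y) (Sum.inr (Sum.inr j)) =
      ((Sxz S * (Lam + Szz S)⁻¹) *ᵥ y) j := by
    intro y
    simp only [mulVec, dotProduct, r2]
  rw [r3, r4, r5]

end Stmt7
end

section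
/- Closed-form mean of a GP prediction under Gaussian-kernel input uncertainty: let μ(z) = Σ_j K(z, z_j) v_j where K is a Gaussian kernel with hyperparameters (σ², Λ), (z, v) jointly Gaussian. Then E[μ(z)] = Σ_j b_j m_{v_j|z_j}, where b_j = σ² |I + S_{zz}Λ⁻¹|^{-1/2} exp(−(1/2)(z_j − m_z)ᵀ(Λ + S_{zz})⁻¹(z_j − m_z)) and m_{v_j|z_j} = m_{v_j} + S_{v_j z}(S_{zz}+Λ)⁻¹(z_j − m_z). -/
open Matrix MeasureTheory Real

open scoped MatrixOrder Matrix.Norms.L2Operator in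
lemma gp_factor {ι : Type} [Fintype ι] [DecidableEq ι] {P : Matrix ι ι ℝ} (hP : P.PosDef) :
    ∃ B : Matrix ι ι ℝ, B.det ≠ 0 ∧ P = Bᵀ * B := by
  obtain ⟨y, hy, rfl⟩ := CStarAlgebra.isStrictlyPositive_iff_eq_star_mul_self.mp hP.isStrictlyPositive
  exact ⟨y, by simpa [Matrix.isUnit_iff_isUnit_det] using hy, by simp [star_eq_conjTranspose]⟩

lemma gp_quad {ι : Type} [Fintype ι] (B : Matrix ι ι ℝ) (y : ι → ℝ) :
    y ⬝ᵥ ((Bᵀ * B) *ᵥ y) = ∑ i, (B *ᵥ y) i ^ 2 := by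
  rw [← mulVec_mulVec, dotProduct_mulVec, vecMul_transpose]
  simp [dotProduct, sq]

lemma gp_std_exp {ι : Type} [Fintype ι] (x : ι → ℝ) :
    Real.exp (-(1/2) * ∑ i, x i ^ 2) = ∏ i, Real.exp (-(1/2) * x i ^ 2) := by
  rw [← Real.exp_sum, Finset.mul_sum]

lemma gp_std_int {ι : Type} [Fintype ι] :
    Integrable (fun x : ι → ℝ => Real.exp (-(1/2) * ∑ i, x i ^ 2)) := by
  simp_rw [gp_std_exp]
  exact Integrable.fintype_prod (f := fun _ t => Real.exp (-(1/2) * t ^ 2))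
    (fun _ => integrable_exp_neg_mul_sq (by norm_num))

lemma gp_std_int1 {ι : Type} [Fintype ι] [DecidableEq ι] (k : ι) :
    Integrable (fun x : ι → ℝ => x k * Real.exp (-(1/2) * ∑ i, x i ^ 2)) := by
  have h := Integrable.fintype_prod (μ := fun _ : ι => (volume : Measure ℝ))
    (f := fun i t => (if i = k then t else 1) * Real.exp (-(1/2) * t ^ 2))
    (fun i => by
      by_cases hi : i = k
      · simpa [hi] using integrable_mul_exp_neg_mul_sq (b := 1/2) (by norm_num)
      · simpa [hi] using integrable_exp_neg_mul_sq (b := 1/2) (by norm_num))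
  simp_rw [gp_std_exp]
  refine h.congr (Filter.Eventually.of_forall fun x => ?_)
  simp only [Finset.prod_mul_distrib]
  simp

lemma gp_std_val {ι : Type} [Fintype ι] :
    ∫ x : ι → ℝ, Real.exp (-(1/2) * ∑ i, x i ^ 2) = (2 * π) ^ ((Fintype.card ι : ℝ) / 2) := by
  simp_rw [gp_std_exp]
  rw [integral_fintype_prod_volume_eq_pow (fun t : ℝ => Real.exp (-(1/2) * t ^ 2)),
    integral_gaussian, Real.sqrt_eq_rpow, ← Real.rpow_natCast, ← Real.rpow_mul (by positivity)]
  congr 1 <;> ring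

lemma gp_map {ι : Type} [Fintype ι] [DecidableEq ι] {B : Matrix ι ι ℝ} (hB : B.det ≠ 0) :
    Measure.map (fun y => B *ᵥ y) (volume : Measure (ι → ℝ)) =
      ENNReal.ofReal (abs (det B)⁻¹) • volume := by
  have := Real.map_matrix_volume_pi_eq_smul_volume_pi hB
  exact this

lemma gp_meas {ι : Type} [Fintype ι] (B : Matrix ι ι ℝ) : Measurable (fun y : ι → ℝ => B *ᵥ y) :=
  (continuous_const.matrix_mulVec continuous_id).measurable

lemma gp_pull_int {ι : Type} [Fintype ι] [DecidableEq ι] {B : Matrix ι ι ℝ} (hB : B.det ≠ 0)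
    {f : (ι → ℝ) → ℝ} (hf : Integrable f) : Integrable (fun y => f (B *ᵥ y)) := by
  have : Integrable f (Measure.map (fun y => B *ᵥ y) (volume : Measure (ι → ℝ))) := by
    rw [gp_map hB]; exact hf.smul_measure ENNReal.ofReal_ne_top
  exact this.comp_measurable (gp_meas B)

lemma gp_pull_val {ι : Type} [Fintype ι] [DecidableEq ι] {B : Matrix ι ι ℝ} (hB : B.det ≠ 0)
    {f : (ι → ℝ) → ℝ} (hf : Integrable f) : ∫ y, f (B *ᵥ y) = |B.det|⁻¹ * ∫ x, f x := by
  have h : Integrable f (Measure.map (fun y => B *ᵥ y) (volume : Measure (ι → ℝ))) := by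
    rw [gp_map hB]; exact hf.smul_measure ENNReal.ofReal_ne_top
  rw [← integral_map (gp_meas B).aemeasurable h.aestronglyMeasurable, gp_map hB,
    integral_smul_measure, ENNReal.toReal_ofReal (abs_nonneg _), abs_inv, smul_eq_mul]

/-- Gaussian normalisation. -/
lemma gp_int {ι : Type} [Fintype ι] [DecidableEq ι] {P : Matrix ι ι ℝ} (hP : P.PosDef) :
    Integrable (fun y : ι → ℝ => Real.exp (-(1/2) * (y ⬝ᵥ (P *ᵥ y)))) := by
  obtain ⟨B, hB, rfl⟩ := gp_factor hP
  simp_rw [gp_quad]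
  exact gp_pull_int hB gp_std_int

lemma gp_val {ι : Type} [Fintype ι] [DecidableEq ι] {P : Matrix ι ι ℝ} (hP : P.PosDef) :
    ∫ y : ι → ℝ, Real.exp (-(1/2) * (y ⬝ᵥ (P *ᵥ y))) =
      P.det ^ (-(1:ℝ)/2) * (2 * π) ^ ((Fintype.card ι : ℝ) / 2) := by
  obtain ⟨B, hB, rfl⟩ := gp_factor hP
  simp_rw [gp_quad]
  rw [gp_pull_val hB gp_std_int, gp_std_val, det_mul, det_transpose, ← abs_mul_abs_self, neg_div,
    Real.rpow_neg (by positivity), ← Real.sqrt_eq_rpow, Real.sqrt_mul_self (abs_nonneg _)]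

lemma gp_int1 {ι : Type} [Fintype ι] [DecidableEq ι] {P : Matrix ι ι ℝ} (hP : P.PosDef) (k : ι) :
    Integrable (fun y : ι → ℝ => y k * Real.exp (-(1/2) * (y ⬝ᵥ (P *ᵥ y)))) := by
  obtain ⟨B, hB, rfl⟩ := gp_factor hP
  simp_rw [gp_quad]
  have h : Integrable (fun x : ι → ℝ =>
      ∑ l, B⁻¹ k l * (x l * Real.exp (-(1/2) * ∑ i, x i ^ 2))) :=
    integrable_finsetSum _ fun l _ => (gp_std_int1 l).const_mul _
  convert gp_pull_int hB h using 2 with y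
  have : y = B⁻¹ *ᵥ (B *ᵥ y) := by
    rw [mulVec_mulVec, nonsing_inv_mul _ (by simpa using hB), one_mulVec]
  conv_lhs => rw [show y k = (B⁻¹ *ᵥ (B *ᵥ y)) k by rw [← this]]
  simp_rw [← mul_assoc]
  rw [← Finset.sum_mul]
  rfl

lemma gp_val1 {ι : Type} [Fintype ι] [DecidableEq ι] (P : Matrix ι ι ℝ) (k : ι) :
    ∫ y : ι → ℝ, y k * Real.exp (-(1/2) * (y ⬝ᵥ (P *ᵥ y))) = 0 := by
  have h := integral_neg_eq_self (fun y : ι → ℝ => y k * Real.exp (-(1/2) * (y ⬝ᵥ (P *ᵥ y)))) volume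
  simp only [Pi.neg_apply, mulVec_neg, dotProduct_neg, neg_dotProduct, neg_neg, neg_mul,
    integral_neg] at h
  simp only [neg_mul]
  linarith

lemma gp_shift_int {ι : Type} [Fintype ι] [DecidableEq ι] {P : Matrix ι ι ℝ} (hP : P.PosDef)
    (c : ι → ℝ) (k : ι) :
    Integrable (fun w : ι → ℝ => Real.exp (-(1/2) * ((w - c) ⬝ᵥ (P *ᵥ (w - c)))) * w k) := by
  have h := (((gp_int1 hP k).add ((gp_int hP).const_mul (c k))).comp_sub_right c)
  convert h using 2 with w
  simp only [Pi.add_apply, Pi.sub_apply]; ring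

lemma gp_shift_val {ι : Type} [Fintype ι] [DecidableEq ι] {P : Matrix ι ι ℝ} (hP : P.PosDef)
    (c : ι → ℝ) (k : ι) :
    ∫ w : ι → ℝ, Real.exp (-(1/2) * ((w - c) ⬝ᵥ (P *ᵥ (w - c)))) * w k =
      P.det ^ (-(1:ℝ)/2) * (2 * π) ^ ((Fintype.card ι : ℝ) / 2) * c k := by
  have h := integral_sub_right_eq_self (μ := (volume : Measure (ι → ℝ)))
    (fun y : ι → ℝ => y k * Real.exp (-(1/2) * (y ⬝ᵥ (P *ᵥ y))) +
      c k * Real.exp (-(1/2) * (y ⬝ᵥ (P *ᵥ y)))) c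
  rw [integral_add (gp_int1 hP k) ((gp_int hP).const_mul (c k)), gp_val1, integral_const_mul,
    gp_val hP] at h
  rw [mul_comm _ (c k), ← zero_add (c k * _), ← h]
  congr 1 with w
  simp only [Pi.sub_apply]; ring

/-- Completing the square. -/
lemma gp_square {ι κ : Type} [Fintype ι] [DecidableEq ι] [Fintype κ] [DecidableEq κ]
    {S : Matrix ι ι ℝ} (hS : S.PosDef) {L : Matrix κ κ ℝ} (hL : L.PosDef) (E : Matrix κ ι ℝ)
    (hT : (L + E * S * Eᵀ).PosDef) (r : κ → ℝ) (y : ι → ℝ) :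
    (y + (S * Eᵀ) *ᵥ ((L + E * S * Eᵀ)⁻¹ *ᵥ r)) ⬝ᵥ
        (S⁻¹ *ᵥ (y + (S * Eᵀ) *ᵥ ((L + E * S * Eᵀ)⁻¹ *ᵥ r))) +
      (E *ᵥ (y + (S * Eᵀ) *ᵥ ((L + E * S * Eᵀ)⁻¹ *ᵥ r)) - r) ⬝ᵥ
        (L⁻¹ *ᵥ (E *ᵥ (y + (S * Eᵀ) *ᵥ ((L + E * S * Eᵀ)⁻¹ *ᵥ r)) - r)) =
    y ⬝ᵥ ((S⁻¹ + Eᵀ * L⁻¹ * E) *ᵥ y) + r ⬝ᵥ ((L + E * S * Eᵀ)⁻¹ *ᵥ r) := by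
  have hSd : IsUnit S.det := hS.det_pos.ne'.isUnit
  have hLd : IsUnit L.det := hL.det_pos.ne'.isUnit
  have hTd : IsUnit (L + E * S * Eᵀ).det := hT.det_pos.ne'.isUnit
  have hSt : Sᵀ = S := by simpa using hS.isHermitian.eq
  have hLt : Lᵀ = L := by simpa using hL.isHermitian.eq
  obtain ⟨s, hs⟩ : ∃ s, s = (L + E * S * Eᵀ)⁻¹ *ᵥ r := ⟨_, rfl⟩
  have hr : r = L *ᵥ s + (E * S * Eᵀ) *ᵥ s := by
    rw [← add_mulVec, hs, mulVec_mulVec, mul_nonsing_inv _ hTd, one_mulVec]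
  rw [← hs]
  have h1 : E *ᵥ (y + (S * Eᵀ) *ᵥ s) - r = E *ᵥ y - L *ᵥ s := by
    rw [hr, mulVec_add, mulVec_mulVec, ← Matrix.mul_assoc]; abel
  have h2 : S⁻¹ *ᵥ (y + (S * Eᵀ) *ᵥ s) = S⁻¹ *ᵥ y + Eᵀ *ᵥ s := by
    rw [mulVec_add, mulVec_mulVec, ← Matrix.mul_assoc, nonsing_inv_mul _ hSd, Matrix.one_mul]
  have h3 : L⁻¹ *ᵥ (E *ᵥ y - L *ᵥ s) = L⁻¹ *ᵥ (E *ᵥ y) - s := by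
    rw [mulVec_sub, mulVec_mulVec s, nonsing_inv_mul _ hLd, one_mulVec]
  rw [h1, h2, h3, hr]
  have e1 : ((S * Eᵀ) *ᵥ s) ⬝ᵥ (S⁻¹ *ᵥ y) = y ⬝ᵥ (Eᵀ *ᵥ s) := by
    rw [dotProduct_mulVec, ← mulVec_transpose, mulVec_mulVec, transpose_nonsing_inv, hSt,
      ← Matrix.mul_assoc, nonsing_inv_mul _ hSd, Matrix.one_mul, dotProduct_comm]
  have e2 : (L *ᵥ s) ⬝ᵥ (L⁻¹ *ᵥ (E *ᵥ y)) = y ⬝ᵥ (Eᵀ *ᵥ s) := by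
    rw [dotProduct_mulVec, ← mulVec_transpose, mulVec_mulVec, transpose_nonsing_inv, hLt,
      nonsing_inv_mul _ hLd, one_mulVec, dotProduct_mulVec y, vecMul_transpose, dotProduct_comm]
  have e3 : (E *ᵥ y) ⬝ᵥ s = y ⬝ᵥ (Eᵀ *ᵥ s) := by
    rw [dotProduct_mulVec y, vecMul_transpose]
  have e4 : ((S * Eᵀ) *ᵥ s) ⬝ᵥ (Eᵀ *ᵥ s) = ((E * S * Eᵀ) *ᵥ s) ⬝ᵥ s := by
    rw [dotProduct_mulVec, vecMul_transpose, mulVec_mulVec, ← Matrix.mul_assoc]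
  have e5 : y ⬝ᵥ ((Eᵀ * L⁻¹ * E) *ᵥ y) = (E *ᵥ y) ⬝ᵥ (L⁻¹ *ᵥ (E *ᵥ y)) := by
    rw [Matrix.mul_assoc, ← mulVec_mulVec, ← mulVec_mulVec, dotProduct_mulVec y, vecMul_transpose]
  simp only [add_dotProduct, sub_dotProduct, dotProduct_add, dotProduct_sub, add_mulVec,
    e1, e2, e3, e4, e5]
  ring

lemma gp_det {ι κ : Type} [Fintype ι] [DecidableEq ι] [Fintype κ] [DecidableEq κ]
    {S : Matrix ι ι ℝ} (hS : S.PosDef) (L : Matrix κ κ ℝ) (E : Matrix κ ι ℝ) :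
    S.det * (S⁻¹ + Eᵀ * L⁻¹ * E).det = (1 + E * S * Eᵀ * L⁻¹).det := by
  rw [← det_mul, Matrix.mul_add, mul_nonsing_inv _ hS.det_pos.ne'.isUnit, ← Matrix.mul_assoc,
    det_one_add_mul_comm]
  simp only [Matrix.mul_assoc]

lemma gp_E_mulVec {d n : ℕ} (w : Fin d ⊕ Fin n → ℝ) :
    ((1 : Matrix (Fin d ⊕ Fin n) (Fin d ⊕ Fin n) ℝ).submatrix Sum.inl id) *ᵥ w =
      fun a => w (Sum.inl a) := by
  ext a
  simp [mulVec, dotProduct, one_apply]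

lemma gp_SE {d n : ℕ} (S : Matrix (Fin d ⊕ Fin n) (Fin d ⊕ Fin n) ℝ) :
    S * ((1 : Matrix (Fin d ⊕ Fin n) (Fin d ⊕ Fin n) ℝ).submatrix Sum.inl id)ᵀ =
      S.submatrix id Sum.inl := by
  ext a b
  simp [mul_apply, one_apply]

lemma gp_ESE {d n : ℕ} (S : Matrix (Fin d ⊕ Fin n) (Fin d ⊕ Fin n) ℝ) :
    ((1 : Matrix (Fin d ⊕ Fin n) (Fin d ⊕ Fin n) ℝ).submatrix Sum.inl id) * S *
      ((1 : Matrix (Fin d ⊕ Fin n) (Fin d ⊕ Fin n) ℝ).submatrix Sum.inl id)ᵀ =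
      Matrix.of fun a b => S (Sum.inl a) (Sum.inl b) := by
  rw [Matrix.mul_assoc, gp_SE]
  ext a b
  simp [mul_apply, one_apply]

/-- Closed-form mean of a GP prediction under Gaussian-kernel input uncertainty:
with `μ(z) = Σ_j K(z, z_j) v_j` and `(z, v)` jointly Gaussian,
`E[μ(z)] = Σ_j b_j m_{v_j|z_j}`. -/
theorem stmt9 (d nU : ℕ)
    (M : (Fin d ⊕ Fin nU) → ℝ) (S : Matrix (Fin d ⊕ Fin nU) (Fin d ⊕ Fin nU) ℝ)
    (hS : S.PosDef)
    (Lam : Matrix (Fin d) (Fin d) ℝ) (hLam : Lam.PosDef)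
    (hLamS : (Lam + Matrix.of fun a b => S (Sum.inl a) (Sum.inl b)).PosDef)
    (sig2 : ℝ) (hsig : 0 < sig2)
    (Z : Fin nU → Fin d → ℝ) :
    (∫ w : (Fin d ⊕ Fin nU) → ℝ,
        gpdf M S w *
          ∑ j : Fin nU,
            sig2 * Real.exp (-(1 / 2) *
                (((fun a => w (Sum.inl a)) - Z j) ⬝ᵥ
                  (Lam⁻¹ *ᵥ ((fun a => w (Sum.inl a)) - Z j)))) *
              w (Sum.inr j))
      = ∑ j : Fin nU,
          (sig2 *
              ((1 : Matrix (Fin d) (Fin d) ℝ) +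
                  (Matrix.of fun a b => S (Sum.inl a) (Sum.inl b)) * Lam⁻¹).det ^
                (-(1 : ℝ) / 2) *
              Real.exp (-(1 / 2) *
                ((Z j - fun a => M (Sum.inl a)) ⬝ᵥ
                  ((Lam + Matrix.of fun a b => S (Sum.inl a) (Sum.inl b))⁻¹ *ᵥ
                    (Z j - fun a => M (Sum.inl a)))))) *
            (M (Sum.inr j) +
              (fun c => S (Sum.inr j) (Sum.inl c)) ⬝ᵥ
                (((Matrix.of fun a b => S (Sum.inl a) (Sum.inl b)) + Lam)⁻¹ *ᵥ
                  (Z j - fun a => M (Sum.inl a)))) := by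
  obtain ⟨E, hE⟩ : ∃ E : Matrix (Fin d) (Fin d ⊕ Fin nU) ℝ,
      E = (1 : Matrix (Fin d ⊕ Fin nU) (Fin d ⊕ Fin nU) ℝ).submatrix Sum.inl id := ⟨_, rfl⟩
  have hEw : ∀ w : Fin d ⊕ Fin nU → ℝ, (fun a => w (Sum.inl a)) = E *ᵥ w := fun w => by
    rw [hE, gp_E_mulVec]
  have hSz : (Matrix.of fun a b => S (Sum.inl a) (Sum.inl b)) = E * S * Eᵀ := by
    rw [hE, gp_ESE]
  have hrow : ∀ (j : Fin nU) (s : Fin d → ℝ),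
      (fun c => S (Sum.inr j) (Sum.inl c)) ⬝ᵥ s = ((S * Eᵀ) *ᵥ s) (Sum.inr j) := fun j s => by
    rw [hE, gp_SE]; rfl
  rw [hSz] at hLamS
  simp_rw [hSz, hrow, hEw, add_comm (E * S * Eᵀ) Lam]
  obtain ⟨P, hPdef⟩ : ∃ P, P = S⁻¹ + Eᵀ * Lam⁻¹ * E := ⟨_, rfl⟩
  have hP : P.PosDef := by
    rw [hPdef]
    refine hS.inv.add_posSemidef ?_
    simpa using hLam.inv.posSemidef.conjTranspose_mul_mul_same E
  have hdet : S.det * P.det = (1 + E * S * Eᵀ * Lam⁻¹).det := hPdef ▸ gp_det hS Lam E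
  obtain ⟨T, hT⟩ : ∃ T, T = Lam + E * S * Eᵀ := ⟨_, rfl⟩
  let c : Fin nU → Fin d ⊕ Fin nU → ℝ := fun j => M + (S * Eᵀ) *ᵥ (T⁻¹ *ᵥ (Z j - E *ᵥ M))
  have key : ∀ (j : Fin nU) (w : Fin d ⊕ Fin nU → ℝ),
      gpdf M S w * (sig2 * Real.exp (-(1 / 2) * ((E *ᵥ w - Z j) ⬝ᵥ (Lam⁻¹ *ᵥ (E *ᵥ w - Z j)))) *
        w (Sum.inr j)) =
      ((2 * Real.pi) ^ (-(Fintype.card (Fin d ⊕ Fin nU) : ℝ) / 2) * S.det ^ (-(1 : ℝ) / 2) * sig2 *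
        Real.exp (-(1 / 2) * ((Z j - E *ᵥ M) ⬝ᵥ (T⁻¹ *ᵥ (Z j - E *ᵥ M))))) *
      (Real.exp (-(1 / 2) * ((w - c j) ⬝ᵥ (P *ᵥ (w - c j)))) * w (Sum.inr j)) := by
    intro j w
    have h := gp_square hS hLam E hLamS (Z j - E *ᵥ M) (w - c j)
    rw [← hT, ← hPdef] at h
    have h1 : w - c j + (S * Eᵀ) *ᵥ (T⁻¹ *ᵥ (Z j - E *ᵥ M)) = w - M := by
      simp only [c]; abel
    have h2 : E *ᵥ (w - M) - (Z j - E *ᵥ M) = E *ᵥ w - Z j := by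
      rw [mulVec_sub]; abel
    rw [h1, h2] at h
    have h3 := congrArg (fun t => Real.exp (-(1 / 2) * t)) h
    simp only [mul_add, Real.exp_add] at h3
    unfold gpdf
    linear_combination ((2 * Real.pi) ^ (-(Fintype.card (Fin d ⊕ Fin nU) : ℝ) / 2) *
      S.det ^ (-(1 : ℝ) / 2) * sig2 * w (Sum.inr j)) * h3
  simp_rw [Finset.mul_sum, key]
  rw [integral_finsetSum _ fun j _ => (gp_shift_int hP (c j) (Sum.inr j)).const_mul _]
  refine Finset.sum_congr rfl fun j _ => ?_
  rw [integral_const_mul, gp_shift_val hP, ← hdet,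
    Real.mul_rpow hS.det_pos.le hP.det_pos.le, ← hT]
  have hpi : (2 * Real.pi) ^ (-(Fintype.card (Fin d ⊕ Fin nU) : ℝ) / 2) *
      (2 * Real.pi) ^ ((Fintype.card (Fin d ⊕ Fin nU) : ℝ) / 2) = 1 := by
    rw [← Real.rpow_add (by positivity), neg_div, neg_add_cancel, Real.rpow_zero]
  have hc : c j (Sum.inr j) =
      M (Sum.inr j) + ((S * Eᵀ) *ᵥ (T⁻¹ *ᵥ (Z j - E *ᵥ M))) (Sum.inr j) := rfl
  rw [← hc]
  linear_combination (S.det ^ (-(1 : ℝ) / 2) * P.det ^ (-(1 : ℝ) / 2) * sig2 *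
    Real.exp (-(1 / 2) * ((Z j - E *ᵥ M) ⬝ᵥ (T⁻¹ *ᵥ (Z j - E *ᵥ M)))) * c j (Sum.inr j)) * hpi
end
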